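/- arXiv:0809.0580 — 4 statements merged into one kernel-verified Lean document; each statement's English description precedes it below -/
import Mathlib

section
/- The function F is monotone non-decreasing on [0,1]: for all x, y with 0 ≤ x ≤ y ≤ 1 one has F(x) ≤ F(y). -/
open Real MeasureTheory Filter Topology

noncomputable section

/-- The Thue–Morse correlation coefficients: `η 0 = 1`, `η 1 = -1/3`,
and for `m ≥ 1`, `η (2m) = η m` and `η (2m+1) = -(η m + η (m+1))/2`. -/
def eta : ℕ → ℝ
  | 0 => 1
  | 1 => -(1 / 3)
  | n + 2 =>
    if (n + 2) % 2 = 0 then eta ((n + 2) / 2)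
    else -(eta ((n + 2) / 2) + eta ((n + 2) / 2 + 1)) / 2
  decreasing_by all_goals omega

/-- The Thue–Morse distribution function
`F(x) = x + ∑_{m≥1} (η(m)/(mπ))·sin(2πmx)`. -/
def F (x : ℝ) : ℝ :=
  x + ∑' m : ℕ, eta (m + 1) / ((m + 1 : ℝ) * π) * Real.sin (2 * π * (m + 1) * x)

theorem eta_zero : eta 0 = 1 := by rw [eta]

theorem eta_one : eta 1 = -(1 / 3) := by rw [eta]

theorem eta_two_mul (m : ℕ) : eta (2 * m) = eta m := by
  rcases m with _ | m
  · rfl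
  · rw [show 2 * (m + 1) = 2 * m + 2 by ring, eta, if_pos (by omega)]
    congr 1
    omega

theorem eta_two_mul_add_one (m : ℕ) : eta (2 * m + 1) = -(eta m + eta (m + 1)) / 2 := by
  rcases m with _ | m
  · norm_num [eta_zero, eta_one]
  · rw [show 2 * (m + 1) + 1 = (2 * m + 1) + 2 by ring, eta, if_neg (by omega),
      show (2 * m + 1 + 2) / 2 = m + 1 by omega]

theorem eta_two_pow (n : ℕ) : eta (2 ^ n) = eta 1 := by
  induction n with
  | zero => rfl
  | succ n ih => rw [pow_succ', eta_two_mul, ih]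

theorem sum_range_two_mul_eq_sum_pairs (f : ℕ → ℝ) (n : ℕ) :
    ∑ i ∈ Finset.range (2 * n), f i = ∑ i ∈ Finset.range n, (f (2 * i) + f (2 * i + 1)) := by
  induction n with
  | zero => simp
  | succ n ih =>
    rw [show 2 * (n + 1) = 2 * n + 1 + 1 by ring, Finset.sum_range_succ, Finset.sum_range_succ, ih,
      Finset.sum_range_succ]
    ring

theorem sum_dyadic_block_succ (g : ℕ → ℝ) (n : ℕ) :
    ∑ m ∈ Finset.range (2 ^ (n + 1)), g (2 ^ (n + 1) + m) =
      ∑ m ∈ Finset.range (2 ^ n), (g (2 * (2 ^ n + m)) + g (2 * (2 ^ n + m) + 1)) := by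
  rw [pow_succ', sum_range_two_mul_eq_sum_pairs]
  refine Finset.sum_congr rfl fun m _ => ?_
  rw [mul_add, add_assoc]

theorem sum_eta_mul_eta_succ_nonpos (n : ℕ) :
    ∑ m ∈ Finset.range (2 ^ (n + 1)), eta (2 ^ (n + 1) + m) * eta (2 ^ (n + 1) + m + 1) ≤ 0 := by
  rw [sum_dyadic_block_succ (fun k => eta k * eta (k + 1))]
  refine Finset.sum_nonpos fun m _ => ?_
  rw [show 2 * (2 ^ n + m) + 1 + 1 = 2 * (2 ^ n + m + 1) by ring, eta_two_mul, eta_two_mul,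
    eta_two_mul_add_one]
  nlinarith [sq_nonneg (eta (2 ^ n + m) + eta (2 ^ n + m + 1))]

theorem sum_eta_succ_sq (n : ℕ) :
    ∑ m ∈ Finset.range (2 ^ n), eta (2 ^ n + m + 1) ^ 2 =
      ∑ m ∈ Finset.range (2 ^ n), eta (2 ^ n + m) ^ 2 := by
  have h := Finset.sum_range_succ (fun m => eta (2 ^ n + m) ^ 2) (2 ^ n)
  rw [Finset.sum_range_succ', ← two_mul, ← pow_succ', add_zero, eta_two_pow, eta_two_pow] at h
  simpa only [add_assoc] using add_right_cancel h

theorem sum_eta_sq_block_succ (n : ℕ) :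
    ∑ m ∈ Finset.range (2 ^ (n + 1)), eta (2 ^ (n + 1) + m) ^ 2 =
      3 / 2 * ∑ m ∈ Finset.range (2 ^ n), eta (2 ^ n + m) ^ 2 +
        1 / 2 * ∑ m ∈ Finset.range (2 ^ n), eta (2 ^ n + m) * eta (2 ^ n + m + 1) := by
  have h : ∑ m ∈ Finset.range (2 ^ (n + 1)), eta (2 ^ (n + 1) + m) ^ 2 =
      5 / 4 * ∑ m ∈ Finset.range (2 ^ n), eta (2 ^ n + m) ^ 2 +
        1 / 4 * ∑ m ∈ Finset.range (2 ^ n), eta (2 ^ n + m + 1) ^ 2 +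
        1 / 2 * ∑ m ∈ Finset.range (2 ^ n), eta (2 ^ n + m) * eta (2 ^ n + m + 1) := by
    rw [sum_dyadic_block_succ (fun k => eta k ^ 2), Finset.mul_sum, Finset.mul_sum,
      Finset.mul_sum, ← Finset.sum_add_distrib, ← Finset.sum_add_distrib]
    refine Finset.sum_congr rfl fun m _ => ?_
    rw [eta_two_mul, eta_two_mul_add_one]
    ring
  rw [h, sum_eta_succ_sq]
  ring

theorem sum_eta_sq_block_le (n : ℕ) :
    ∑ m ∈ Finset.range (2 ^ n), eta (2 ^ n + m) ^ 2 ≤ (3 / 2) ^ n := by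
  induction n with
  | zero => norm_num [eta_one]
  | succ n ih =>
    rw [sum_eta_sq_block_succ, pow_succ']
    rcases n with _ | n
    · have h2 : eta 2 = -(1 / 3) := (eta_two_pow 1).trans eta_one
      norm_num [eta_one, h2]
    · linarith [sum_eta_mul_eta_succ_nonpos n]

theorem sum_abs_eta_block_le (n : ℕ) :
    ∑ m ∈ Finset.range (2 ^ n), |eta (2 ^ n + m)| ≤ (7 / 4) ^ n := by
  refine (pow_le_pow_iff_left₀ (by positivity) (by positivity) two_ne_zero).1 ?_
  calc (∑ m ∈ Finset.range (2 ^ n), |eta (2 ^ n + m)|) ^ 2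
      ≤ 2 ^ n * ∑ m ∈ Finset.range (2 ^ n), eta (2 ^ n + m) ^ 2 := by
        simpa using sq_sum_le_card_mul_sum_sq (s := Finset.range (2 ^ n))
          (f := fun m => |eta (2 ^ n + m)|)
    _ ≤ 2 ^ n * (3 / 2) ^ n := by gcongr; exact sum_eta_sq_block_le n
    _ = 3 ^ n := by rw [← mul_pow]; norm_num
    _ ≤ ((7 / 4) ^ n) ^ 2 := by
        rw [← pow_mul, mul_comm, pow_mul]
        gcongr
        norm_num

theorem sum_range_abs_eta_div_le (n : ℕ) :
    ∑ k ∈ Finset.range (2 ^ n), |eta k| / k ≤ 8 - 8 * (7 / 8) ^ n := by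
  induction n with
  | zero => simp
  | succ n ih =>
    rw [pow_succ 2, mul_two, Finset.sum_range_add]
    have h : ∑ m ∈ Finset.range (2 ^ n), |eta (2 ^ n + m)| / ((2 ^ n + m : ℕ) : ℝ) ≤
        (7 / 8) ^ n := by
      calc ∑ m ∈ Finset.range (2 ^ n), |eta (2 ^ n + m)| / ((2 ^ n + m : ℕ) : ℝ)
          ≤ ∑ m ∈ Finset.range (2 ^ n), |eta (2 ^ n + m)| / 2 ^ n := by
            gcongr with m
            push_cast
            linarith [(Nat.cast_nonneg m : (0 : ℝ) ≤ m)]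
        _ ≤ (7 / 4) ^ n / 2 ^ n := by
            rw [← Finset.sum_div]
            gcongr
            exact sum_abs_eta_block_le n
        _ = (7 / 8) ^ n := by rw [← div_pow]; norm_num
    rw [pow_succ]
    linarith

theorem summable_abs_eta_div : Summable fun k : ℕ => |eta k| / (k : ℝ) := by
  refine summable_of_sum_range_le (c := 8) (fun k => by positivity) fun n => ?_
  calc ∑ k ∈ Finset.range n, |eta k| / (k : ℝ)
      ≤ ∑ k ∈ Finset.range (2 ^ n), |eta k| / (k : ℝ) :=
        Finset.sum_le_sum_of_subset_of_nonneg
          (Finset.range_mono Nat.lt_two_pow_self.le) fun k _ _ => by positivity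
    _ ≤ 8 - 8 * (7 / 8) ^ n := sum_range_abs_eta_div_le n
    _ ≤ 8 := by linarith [show (0 : ℝ) ≤ (7 / 8) ^ n by positivity]

theorem summable_F_series (x : ℝ) : Summable fun m : ℕ =>
    eta (m + 1) / ((m + 1 : ℝ) * π) * Real.sin (2 * π * (m + 1) * x) := by
  refine Summable.of_norm_bounded ((summable_nat_add_iff 1).2 summable_abs_eta_div) fun m => ?_
  have hm : (0 : ℝ) < m + 1 := by positivity
  rw [norm_mul, norm_div, Real.norm_eq_abs, Real.norm_eq_abs, Real.norm_eq_abs,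
    abs_of_pos (mul_pos hm Real.pi_pos)]
  push_cast
  calc |eta (m + 1)| / ((m + 1) * π) * |Real.sin (2 * π * (m + 1) * x)|
      ≤ |eta (m + 1)| / ((m + 1) * π) * 1 := by gcongr; exact Real.abs_sin_le_one _
    _ ≤ |eta (m + 1)| / (m + 1) := by
        rw [mul_one]
        gcongr
        nlinarith [Real.pi_gt_three]

/-- The even extension of `eta` to the integers. -/
def etaInt (k : ℤ) : ℝ := eta k.natAbs

theorem etaInt_neg (k : ℤ) : etaInt (-k) = etaInt k := by simp [etaInt]

theorem etaInt_two_mul (k : ℤ) : etaInt (2 * k) = etaInt k := by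
  simp [etaInt, Int.natAbs_mul, eta_two_mul]

theorem etaInt_two_mul_add_one (k : ℤ) :
    etaInt (2 * k + 1) = -(etaInt k + etaInt (k + 1)) / 2 := by
  rcases le_or_gt 0 k with hk | hk
  · obtain ⟨n, rfl⟩ := Int.eq_ofNat_of_zero_le hk
    exact eta_two_mul_add_one n
  · obtain ⟨n, hn⟩ := Int.eq_ofNat_of_zero_le (show 0 ≤ -k - 1 by omega)
    obtain rfl : k = -((n : ℤ) + 1) := by omega
    rw [show 2 * -((n : ℤ) + 1) + 1 = -(2 * (n : ℤ) + 1) by ring,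
      show -((n : ℤ) + 1) + 1 = -(n : ℤ) by ring, etaInt_neg, etaInt_neg, etaInt_neg,
      add_comm (etaInt _)]
    exact eta_two_mul_add_one n

/-- The bilinear form of the Toeplitz matrix `(η(|i - j|))` of size `n`. -/
def toeplitzForm (n : ℕ) (z w : ℕ → ℝ) : ℝ :=
  ∑ i ∈ Finset.range n, ∑ j ∈ Finset.range n, etaInt (i - j) * z i * w j

theorem toeplitzForm_comm (n : ℕ) (z w : ℕ → ℝ) : toeplitzForm n z w = toeplitzForm n w z := by
  rw [toeplitzForm, Finset.sum_comm]
  refine Finset.sum_congr rfl fun i _ => Finset.sum_congr rfl fun j _ => ?_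
  rw [← etaInt_neg, neg_sub]
  ring

theorem toeplitzForm_sub_self (n : ℕ) (z w : ℕ → ℝ) :
    toeplitzForm n (fun i => z i - w i) (fun i => z i - w i) =
      toeplitzForm n z z - 2 * toeplitzForm n z w + toeplitzForm n w w := by
  have h : toeplitzForm n (fun i => z i - w i) (fun i => z i - w i) =
      toeplitzForm n z z - toeplitzForm n z w - toeplitzForm n w z + toeplitzForm n w w := by
    simp only [toeplitzForm, ← Finset.sum_add_distrib, ← Finset.sum_sub_distrib]
    refine Finset.sum_congr rfl fun i _ => Finset.sum_congr rfl fun j _ => ?_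
    ring
  rw [h, toeplitzForm_comm n w z]
  ring

/-- Truncation of a sequence to the indices below `n`. -/
def truncate (n : ℕ) (z : ℕ → ℝ) (i : ℕ) : ℝ := if i < n then z i else 0

/-- Right shift of a sequence, with `0` in front. -/
def shiftRight (z : ℕ → ℝ) : ℕ → ℝ
  | 0 => 0
  | i + 1 => z i

theorem sum_range_succ_truncate (n : ℕ) (z f : ℕ → ℝ) :
    ∑ i ∈ Finset.range (n + 1), f i * truncate n z i = ∑ i ∈ Finset.range n, f i * z i := by
  rw [Finset.sum_range_succ, truncate, if_neg (lt_irrefl n), mul_zero, add_zero]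
  refine Finset.sum_congr rfl fun i hi => ?_
  rw [truncate, if_pos (Finset.mem_range.1 hi)]

theorem sum_range_succ_shiftRight (n : ℕ) (z f : ℕ → ℝ) :
    ∑ i ∈ Finset.range (n + 1), f i * shiftRight z i =
      ∑ i ∈ Finset.range n, f (i + 1) * z i := by
  simp [Finset.sum_range_succ', shiftRight]

theorem toeplitzForm_eq_sum_mul (n : ℕ) (z w : ℕ → ℝ) : toeplitzForm n z w =
    ∑ i ∈ Finset.range n, (∑ j ∈ Finset.range n, etaInt (i - j) * w j) * z i := by
  refine Finset.sum_congr rfl fun i _ => ?_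
  rw [Finset.sum_mul]
  exact Finset.sum_congr rfl fun j _ => by ring

theorem toeplitzForm_truncate (n : ℕ) (z : ℕ → ℝ) :
    toeplitzForm (n + 1) (truncate n z) (truncate n z) = toeplitzForm n z z := by
  rw [toeplitzForm_eq_sum_mul, sum_range_succ_truncate n z, toeplitzForm_eq_sum_mul]
  refine Finset.sum_congr rfl fun i _ => ?_
  rw [sum_range_succ_truncate n z]

theorem toeplitzForm_shiftRight (n : ℕ) (z : ℕ → ℝ) :
    toeplitzForm (n + 1) (shiftRight z) (shiftRight z) = toeplitzForm n z z := by
  rw [toeplitzForm_eq_sum_mul, sum_range_succ_shiftRight n z, toeplitzForm_eq_sum_mul]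
  refine Finset.sum_congr rfl fun i _ => ?_
  rw [sum_range_succ_shiftRight n z]
  congr 1
  refine Finset.sum_congr rfl fun j _ => ?_
  push_cast
  rw [add_sub_add_right_eq_sub]

theorem toeplitzForm_truncate_shiftRight (n : ℕ) (z w : ℕ → ℝ) :
    toeplitzForm (n + 1) (truncate n z) (shiftRight w) =
      ∑ i ∈ Finset.range n, ∑ j ∈ Finset.range n, etaInt (i - j - 1) * z i * w j := by
  rw [toeplitzForm_eq_sum_mul, sum_range_succ_truncate n z]
  refine Finset.sum_congr rfl fun i _ => ?_
  rw [sum_range_succ_shiftRight n w, Finset.sum_mul]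
  refine Finset.sum_congr rfl fun j _ => ?_
  push_cast
  rw [sub_add_eq_sub_sub]
  ring

/-- Splitting into even and odd indices reduces the form of size `2n` to forms of size `n`
and `n + 1`. -/
theorem toeplitzForm_two_mul (n : ℕ) (z : ℕ → ℝ) :
    toeplitzForm (2 * n) z z =
      (toeplitzForm n (fun i => z (2 * i) - z (2 * i + 1)) (fun i => z (2 * i) - z (2 * i + 1)) +
        toeplitzForm (n + 1)
          (fun i => truncate n (fun i => z (2 * i)) i - shiftRight (fun i => z (2 * i + 1)) i)
          (fun i => truncate n (fun i => z (2 * i)) i - shiftRight (fun i => z (2 * i + 1)) i)) /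
        2 := by
  set u : ℕ → ℝ := fun i => z (2 * i) with hu
  set v : ℕ → ℝ := fun i => z (2 * i + 1) with hv
  have hsplit : toeplitzForm (2 * n) z z =
      toeplitzForm n u u + toeplitzForm n v v +
        (∑ i ∈ Finset.range n, ∑ j ∈ Finset.range n, etaInt (2 * (i - j - 1) + 1) * u i * v j) +
        ∑ i ∈ Finset.range n, ∑ j ∈ Finset.range n, etaInt (2 * (i - j - 1) + 1) * u i * v j := by
    nth_rewrite 2 [Finset.sum_comm]
    simp only [toeplitzForm, sum_range_two_mul_eq_sum_pairs, ← Finset.sum_add_distrib]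
    refine Finset.sum_congr rfl fun i _ => Finset.sum_congr rfl fun j _ => ?_
    push_cast
    rw [← etaInt_two_mul ((i : ℤ) - j), ← etaInt_neg (2 * ((j : ℤ) - i - 1) + 1), hu, hv]
    ring_nf
  have hcross : ∑ i ∈ Finset.range n, ∑ j ∈ Finset.range n,
      etaInt (2 * (i - j - 1) + 1) * u i * v j =
      -(toeplitzForm n u v + toeplitzForm (n + 1) (truncate n u) (shiftRight v)) / 2 := by
    rw [toeplitzForm_truncate_shiftRight, toeplitzForm, neg_div, add_div, Finset.sum_div,
      Finset.sum_div, ← Finset.sum_add_distrib, ← Finset.sum_neg_distrib]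
    refine Finset.sum_congr rfl fun i _ => ?_
    rw [Finset.sum_div, Finset.sum_div, ← Finset.sum_add_distrib, ← Finset.sum_neg_distrib]
    refine Finset.sum_congr rfl fun j _ => ?_
    rw [etaInt_two_mul_add_one, sub_add_cancel]
    ring
  rw [hsplit, hcross, toeplitzForm_sub_self, toeplitzForm_sub_self, toeplitzForm_truncate,
    toeplitzForm_shiftRight]
  ring

theorem toeplitzForm_self_nonneg (n : ℕ) (z : ℕ → ℝ) : 0 ≤ toeplitzForm n z z := by
  induction n using Nat.strong_induction_on generalizing z with
  | _ n ih =>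
    have two_mul_case : ∀ m, m + 1 < n → ∀ z, 0 ≤ toeplitzForm (2 * m) z z := fun m hm z => by
      rw [toeplitzForm_two_mul]
      exact div_nonneg (add_nonneg (ih m (by omega) _) (ih (m + 1) hm _)) (by norm_num)
    rcases lt_or_ge n 4 with hn | hn
    · interval_cases n
      · simp [toeplitzForm]
      · simpa [toeplitzForm, etaInt, eta_zero] using mul_self_nonneg (z 0)
      · simp [toeplitzForm, Finset.sum_range_succ, etaInt, eta_zero, eta_one]
        nlinarith [sq_nonneg (z 0 - z 1), sq_nonneg (z 0), sq_nonneg (z 1)]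
      · have h2 : eta 2 = -(1 / 3) := (eta_two_pow 1).trans eta_one
        simp [toeplitzForm, Finset.sum_range_succ, etaInt, eta_zero, eta_one, h2]
        nlinarith [sq_nonneg (z 0 - z 1), sq_nonneg (z 0 - z 2), sq_nonneg (z 1 - z 2),
          sq_nonneg (z 0), sq_nonneg (z 1), sq_nonneg (z 2)]
    · rcases Nat.even_or_odd' n with ⟨m, rfl | rfl⟩
      · exact two_mul_case m (by omega) z
      · rw [← toeplitzForm_truncate]
        exact two_mul_case (m + 1) (by omega) _

theorem sum_etaInt_mul_cos_nonneg (n : ℕ) (t : ℝ) :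
    0 ≤ ∑ i ∈ Finset.range n, ∑ j ∈ Finset.range n,
      etaInt (i - j) * Real.cos (((i - j : ℤ) : ℝ) * t) := by
  have h := add_nonneg (toeplitzForm_self_nonneg n fun i => Real.cos (i * t))
    (toeplitzForm_self_nonneg n fun i => Real.sin (i * t))
  refine h.trans_eq ?_
  simp only [toeplitzForm, ← Finset.sum_add_distrib]
  refine Finset.sum_congr rfl fun i _ => Finset.sum_congr rfl fun j _ => ?_
  push_cast
  rw [sub_mul, Real.cos_sub]
  ring

theorem sum_sum_sub_eq_sum_partial_sums (h : ℤ → ℝ) (h_even : ∀ k, h (-k) = h k) (n : ℕ) :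
    ∑ i ∈ Finset.range n, ∑ j ∈ Finset.range n, h (i - j) =
      ∑ k ∈ Finset.range n, (h 0 + 2 * ∑ m ∈ Finset.range k, h (m + 1)) := by
  induction n with
  | zero => simp
  | succ n ih =>
    have hrefl : ∑ j ∈ Finset.range n, h (n - j) = ∑ m ∈ Finset.range n, h (m + 1) := by
      rw [← Finset.sum_range_reflect]
      refine Finset.sum_congr rfl fun m hm => ?_
      have := Finset.mem_range.1 hm
      congr 1
      omega
    have hcol : ∑ i ∈ Finset.range n, h (i - n) = ∑ j ∈ Finset.range n, h (n - j) :=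
      Finset.sum_congr rfl fun i _ => by rw [← h_even, neg_sub]
    rw [Finset.sum_range_succ _ n, Finset.sum_range_succ _ n, Finset.sum_range_succ _ n, ← ih]
    simp only [Finset.sum_range_succ, Finset.sum_add_distrib]
    rw [hcol, hrefl, sub_self]
    ring

/-- The primitive of `x ↦ cos (2πkx)` vanishing at `0`. -/
def cosPrimitive (k : ℤ) (x : ℝ) : ℝ :=
  if k = 0 then x else Real.sin (k * (2 * π * x)) / (2 * π * k)

theorem hasDerivAt_cosPrimitive (k : ℤ) (x : ℝ) :
    HasDerivAt (cosPrimitive k) (Real.cos (k * (2 * π * x))) x := by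
  by_cases hk : k = 0
  · subst hk
    have : cosPrimitive 0 = id := by ext y; simp [cosPrimitive]
    rw [this]
    simpa using hasDerivAt_id x
  · have : cosPrimitive k = fun y => Real.sin (k * (2 * π * y)) / (2 * π * k) := by
      ext y; simp [cosPrimitive, hk]
    rw [this]
    have hk' : (k : ℝ) ≠ 0 := Int.cast_ne_zero.2 hk
    have h := ((((hasDerivAt_id x).const_mul (2 * π)).const_mul (k : ℝ)).sin).div_const (2 * π * k)
    refine h.congr_deriv ?_
    simp only [id]
    field_simp [Real.pi_ne_zero]

theorem monotone_sum_etaInt_mul_cosPrimitive (n : ℕ) :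
    Monotone fun x => ∑ i ∈ Finset.range n, ∑ j ∈ Finset.range n,
      etaInt (i - j) * cosPrimitive (i - j) x := by
  refine monotone_of_hasDerivAt_nonneg (f' := fun x => ∑ i ∈ Finset.range n,
    ∑ j ∈ Finset.range n, etaInt (i - j) * Real.cos (((i - j : ℤ) : ℝ) * (2 * π * x)))
    (fun x => ?_) fun x => sum_etaInt_mul_cos_nonneg n _
  exact HasDerivAt.fun_sum fun i _ => HasDerivAt.fun_sum fun j _ =>
    (hasDerivAt_cosPrimitive _ x).const_mul _

theorem tendsto_partial_sums_F (x : ℝ) :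
    Tendsto (fun n : ℕ => etaInt 0 * cosPrimitive 0 x +
      2 * ∑ m ∈ Finset.range n, etaInt (m + 1) * cosPrimitive (m + 1) x) atTop (𝓝 (F x)) := by
  have h := (summable_F_series x).hasSum.tendsto_sum_nat.const_add x
  refine h.congr fun n => ?_
  congr 1
  · simp [etaInt, cosPrimitive, eta_zero]
  · rw [Finset.mul_sum]
    refine Finset.sum_congr rfl fun m _ => ?_
    have hm : ((m : ℤ) + 1) ≠ 0 := by omega
    have hm' : (m : ℝ) + 1 ≠ 0 := by positivity
    rw [cosPrimitive, if_neg hm, etaInt, show ((m : ℤ) + 1).natAbs = m + 1 by omega]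
    push_cast
    rw [show 2 * π * (m + 1) * x = (m + 1) * (2 * π * x) by ring]
    field_simp [Real.pi_ne_zero]

theorem tendsto_cesaro_F (x : ℝ) :
    Tendsto (fun n : ℕ => (n : ℝ)⁻¹ * ∑ i ∈ Finset.range n, ∑ j ∈ Finset.range n,
      etaInt (i - j) * cosPrimitive (i - j) x) atTop (𝓝 (F x)) := by
  refine (tendsto_partial_sums_F x).cesaro.congr fun n => ?_
  rw [sum_sum_sub_eq_sum_partial_sums (fun k => etaInt k * cosPrimitive k x) fun k => ?_]
  simp [etaInt_neg, cosPrimitive, neg_mul, Real.sin_neg]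

/-- `F` is monotone non-decreasing on `[0,1]`. -/
theorem F_monotoneOn :
    ∀ x y : ℝ, 0 ≤ x → x ≤ y → y ≤ 1 → F x ≤ F y := by
  intro x y _ hxy _
  refine le_of_tendsto_of_tendsto' (tendsto_cesaro_F x) (tendsto_cesaro_F y) fun n => ?_
  exact mul_le_mul_of_nonneg_left (monotone_sum_etaInt_mul_cosPrimitive n hxy) (by positivity)
end
end

section
/- If g ∈ L¹([0,1]) satisfies, for almost every x ∈ [0,1], the two functional equations (1/2)·(g(x/2) + g((x+1)/2)) = g(x) and (1/2)·(g(x/2) − g((x+1)/2)) = −cos(πx)·g(x), then g(x) = 0 for almost every x ∈ [0,1]. -/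
open Real MeasureTheory Filter Topology

noncomputable section

/-- A function in `L¹([0,1])` all of whose Fourier coefficients vanish is zero almost everywhere. -/
theorem ae_eq_zero_of_integral_fourier_mul_eq_zero {f : ℝ → ℂ}
    (hf : IntegrableOn f (Set.Icc 0 1) volume)
    (h : ∀ n : ℤ, ∫ x in (0 : ℝ)..1, fourier n (x : AddCircle (1 : ℝ)) * f x = 0) :
    ∀ᵐ x, x ∈ Set.Ioo (0 : ℝ) 1 → f x = 0 := by
  have hfi : IntervalIntegrable f volume 0 1 :=
    (intervalIntegrable_iff_integrableOn_Icc_of_le zero_le_one).2 hf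
  have hint (φ : C(AddCircle (1 : ℝ), ℂ)) :
      IntervalIntegrable (fun x : ℝ => φ (x : AddCircle (1 : ℝ)) * f x) volume 0 1 :=
    hfi.continuousOn_mul
      (φ.continuous.comp (AddCircle.continuous_mk' (1 : ℝ))).continuousOn
  let L₀ : C(AddCircle (1 : ℝ), ℂ) →ₗ[ℂ] ℂ :=
    { toFun := fun φ => ∫ x in (0 : ℝ)..1, φ (x : AddCircle (1 : ℝ)) * f x
      map_add' := fun φ ψ => by
        rw [← intervalIntegral.integral_add (hint φ) (hint ψ)]
        simp only [ContinuousMap.add_apply, add_mul]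
      map_smul' := fun c φ => by
        simp only [ContinuousMap.smul_apply, smul_eq_mul, mul_assoc, RingHom.id_apply]
        exact intervalIntegral.integral_const_mul _ _ }
  let L : C(AddCircle (1 : ℝ), ℂ) →L[ℂ] ℂ :=
    L₀.mkContinuous (∫ x in (0 : ℝ)..1, ‖f x‖) fun φ => by
      rw [mul_comm, ← intervalIntegral.integral_const_mul]
      refine intervalIntegral.norm_integral_le_of_norm_le zero_le_one ?_ (hfi.norm.const_mul _)
      refine Eventually.of_forall fun x _ => ?_
      rw [norm_mul]
      gcongr
      exact φ.norm_coe_le_norm _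
  have hL : ∀ φ, L φ = 0 := by
    intro φ
    have hle : Submodule.span ℂ (Set.range (fourier (T := (1 : ℝ)))) ≤ L.ker := by
      rw [Submodule.span_le]
      rintro _ ⟨n, rfl⟩
      exact h n
    have hcl := Submodule.topologicalClosure_minimal _ hle L.isClosed_ker
    rw [span_fourier_closure_eq_top] at hcl
    exact hcl Submodule.mem_top
  refine isOpen_Ioo.ae_eq_zero_of_integral_contDiff_smul_eq_zero
    (hf.mono_set Set.Ioo_subset_Icc_self).locallyIntegrableOn ?_
  intro φ hφ _ hsupp
  have hzero : ∀ x, x ∉ Set.Ioo (0 : ℝ) 1 → φ x = 0 := fun x hx =>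
    image_eq_zero_of_notMem_tsupport fun hx' => hx (hsupp hx')
  have hφc : Continuous fun x => (φ x : ℂ) := Complex.continuous_ofReal.comp hφ.continuous
  let ψ : C(AddCircle (1 : ℝ), ℂ) :=
    ⟨AddCircle.liftIco 1 0 fun x => (φ x : ℂ),
      AddCircle.liftIco_zero_continuous (by rw [hzero 0 (by simp), hzero 1 (by simp)])
        hφc.continuousOn⟩
  have hψ : ∫ x in (0 : ℝ)..1, ψ (x : AddCircle (1 : ℝ)) * f x = 0 := hL ψ
  rw [intervalIntegral.integral_of_le zero_le_one, integral_Ioc_eq_integral_Ioo] at hψ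
  rw [← setIntegral_eq_integral_of_forall_compl_eq_zero (s := Set.Ioo (0 : ℝ) 1)
    fun x hx => by rw [hzero x hx, zero_smul], ← hψ]
  refine setIntegral_congr_fun measurableSet_Ioo fun x hx => ?_
  have : ψ (x : AddCircle (1 : ℝ)) = φ x :=
    AddCircle.liftIco_zero_coe_apply (f := fun x => (φ x : ℂ)) (Set.Ioo_subset_Ico_self hx)
  simp only [this, Complex.real_smul]

/-- Fourier coefficients of a fixed point of the transfer operator of the doubling map are
invariant under doubling the frequency. -/
theorem integral_fourier_two_mul_of_doubling_transfer {f : ℝ → ℂ}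
    (hf : IntegrableOn f (Set.Icc 0 1) volume)
    (h : ∀ᵐ x ∂(volume.restrict (Set.Icc (0 : ℝ) 1)),
      (1 / 2) * (f (x / 2) + f ((x + 1) / 2)) = f x) (n : ℤ) :
    ∫ x in (0 : ℝ)..1, fourier (2 * n) (x : AddCircle (1 : ℝ)) * f x =
      ∫ x in (0 : ℝ)..1, fourier n (x : AddCircle (1 : ℝ)) * f x := by
  set F : ℝ → ℂ := fun x => fourier (2 * n) (x : AddCircle (1 : ℝ)) * f x with hF
  have hFi : IntervalIntegrable F volume 0 1 :=
    ((intervalIntegrable_iff_integrableOn_Icc_of_le zero_le_one).2 hf).continuousOn_mul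
      ((fourier (2 * n)).continuous.comp (AddCircle.continuous_mk' (1 : ℝ))).continuousOn
  have hl : IntervalIntegrable F volume 0 (1 / 2) :=
    hFi.mono_set (by rw [Set.uIcc_of_le, Set.uIcc_of_le] <;> norm_num; gcongr; norm_num)
  have hr : IntervalIntegrable F volume (1 / 2) 1 :=
    hFi.mono_set (by rw [Set.uIcc_of_le, Set.uIcc_of_le] <;> norm_num; gcongr; norm_num)
  have hl' : IntervalIntegrable (fun x => F (x / 2)) volume 0 1 := by
    have := hl.comp_mul_right (c := (2 : ℝ)⁻¹)
    simpa [div_eq_mul_inv] using this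
  have hr' : IntervalIntegrable (fun x => F ((x + 1) / 2)) volume 0 1 := by
    have := (hr.comp_mul_right (c := (2 : ℝ)⁻¹)).comp_add_right 1
    norm_num at this
    simpa [div_eq_mul_inv] using this
  have key : ∀ᵐ x, x ∈ Set.uIoc (0 : ℝ) 1 →
      fourier n (x : AddCircle (1 : ℝ)) * f x =
        (1 / 2) * (F (x / 2) + F ((x + 1) / 2)) := by
    rw [ae_restrict_iff' measurableSet_Icc] at h
    filter_upwards [h] with x hx hx'
    rw [Set.uIoc_of_le zero_le_one] at hx'
    rw [← hx (Set.Ioc_subset_Icc_self hx')]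
    have e1 : fourier (2 * n) ((x / 2 : ℝ) : AddCircle (1 : ℝ)) =
        fourier n (x : AddCircle (1 : ℝ)) := by
      rw [fourier_coe_apply, fourier_coe_apply]
      congr 1
      push_cast
      ring
    have e2 : fourier (2 * n) (((x + 1) / 2 : ℝ) : AddCircle (1 : ℝ)) =
        fourier n (x : AddCircle (1 : ℝ)) := by
      rw [fourier_coe_apply, fourier_coe_apply, Complex.exp_eq_exp_iff_exists_int]
      refine ⟨n, ?_⟩
      push_cast
      ring
    simp only [hF, e1, e2]
    ring
  rw [intervalIntegral.integral_congr_ae key, intervalIntegral.integral_const_mul,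
    intervalIntegral.integral_add hl' hr',
    ← intervalIntegral.integral_add_adjacent_intervals hl hr]
  have i1 : ∫ x in (0 : ℝ)..1, F (x / 2) = 2 * ∫ x in (0 : ℝ)..(1 / 2), F x := by
    rw [intervalIntegral.integral_comp_div F two_ne_zero]
    simp
  have i2 : ∫ x in (0 : ℝ)..1, F ((x + 1) / 2) = 2 * ∫ x in (1 / 2 : ℝ)..1, F x := by
    rw [intervalIntegral.integral_comp_add_right (fun x => F (x / 2)),
      intervalIntegral.integral_comp_div F two_ne_zero]
    norm_num
  rw [i1, i2]
  ring

/-- The Riemann-Lebesgue lemma along the frequencies `2 ^ k * n`. -/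
theorem tendsto_integral_fourier_two_pow_mul (f : ℝ → ℂ) {n : ℤ} (hn : n ≠ 0) :
    Tendsto (fun k : ℕ => ∫ x in (0 : ℝ)..1, fourier (2 ^ k * n) (x : AddCircle (1 : ℝ)) * f x)
      atTop (𝓝 0) := by
  have hRL := Real.tendsto_integral_exp_smul_cocompact ((Set.Ioc (0 : ℝ) 1).indicator f)
  have hcoc : Tendsto (fun k : ℕ => -((2 ^ k * n : ℤ) : ℝ)) atTop (cocompact ℝ) := by
    rw [← Metric.cobounded_eq_cocompact, ← tendsto_norm_atTop_iff_cobounded]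
    have : ∀ k : ℕ, ‖-((2 ^ k * n : ℤ) : ℝ)‖ = 2 ^ k * |(n : ℝ)| := by
      intro k
      simp
    simp only [this]
    exact (tendsto_pow_atTop_atTop_of_one_lt one_lt_two).atTop_mul_const (by positivity)
  refine (hRL.comp hcoc).congr fun k => ?_
  rw [intervalIntegral.integral_of_le zero_le_one, ← integral_indicator measurableSet_Ioc]
  refine integral_congr_ae (Eventually.of_forall fun x => ?_)
  by_cases hx : x ∈ Set.Ioc (0 : ℝ) 1
  · simp only [Set.indicator_of_mem hx, Circle.smul_def, smul_eq_mul, fourier_coe_apply,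
      Real.fourierChar_apply]
    congr 2
    push_cast
    ring
  · simp [Set.indicator_of_notMem hx]

/-- An integrable fixed point of the transfer operator of the doubling map is constant. -/
theorem ae_const_of_doubling_transfer {f : ℝ → ℂ}
    (hf : IntegrableOn f (Set.Icc 0 1) volume)
    (h : ∀ᵐ x ∂(volume.restrict (Set.Icc (0 : ℝ) 1)),
      (1 / 2) * (f (x / 2) + f ((x + 1) / 2)) = f x) :
    ∀ᵐ x, x ∈ Set.Ioo (0 : ℝ) 1 → f x = ∫ t in (0 : ℝ)..1, f t := by
  set c := ∫ t in (0 : ℝ)..1, f t with hc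
  have hcoeff : ∀ n : ℤ, n ≠ 0 →
      ∫ x in (0 : ℝ)..1, fourier n (x : AddCircle (1 : ℝ)) * f x = 0 := by
    intro n hn
    have hpow : ∀ k : ℕ, ∫ x in (0 : ℝ)..1, fourier (2 ^ k * n) (x : AddCircle (1 : ℝ)) * f x =
        ∫ x in (0 : ℝ)..1, fourier n (x : AddCircle (1 : ℝ)) * f x := by
      intro k
      induction k with
      | zero => simp only [pow_zero, one_mul]
      | succ k ih =>
        rw [pow_succ', mul_assoc, integral_fourier_two_mul_of_doubling_transfer hf h, ih]
    exact tendsto_nhds_unique (tendsto_const_nhds.congr fun k => (hpow k).symm)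
      (tendsto_integral_fourier_two_pow_mul f hn)
  have hconst : IntegrableOn (fun _ : ℝ => c) (Set.Icc (0 : ℝ) 1) volume :=
    continuousOn_const.integrableOn_Icc
  have hz := ae_eq_zero_of_integral_fourier_mul_eq_zero (hf.sub hconst) fun n => ?_
  · filter_upwards [hz] with x hx hx'
    exact sub_eq_zero.1 (hx hx')
  have hcont : ContinuousOn (fun x : ℝ => fourier n (x : AddCircle (1 : ℝ)))
      (Set.uIcc (0 : ℝ) 1) :=
    ((fourier n).continuous.comp (AddCircle.continuous_mk' (1 : ℝ))).continuousOn
  have hfi : IntervalIntegrable f volume 0 1 :=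
    (intervalIntegrable_iff_integrableOn_Icc_of_le zero_le_one).2 hf
  simp only [Pi.sub_apply, mul_sub]
  rw [intervalIntegral.integral_sub (hfi.continuousOn_mul hcont)
    ((hcont.intervalIntegrable).mul_const c), intervalIntegral.integral_mul_const]
  rcases eq_or_ne n 0 with rfl | hn
  · simp [hc]
  · have hexp : ∫ x in (0 : ℝ)..1, fourier n (x : AddCircle (1 : ℝ)) = 0 := by
      have hd : (2 * π * Complex.I * n : ℂ) ≠ 0 := by
        simp [hn, Real.pi_ne_zero]
      simp only [fourier_coe_apply, Complex.ofReal_one, div_one]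
      rw [integral_exp_mul_complex hd]
      have : Complex.exp (2 * π * Complex.I * n) = 1 :=
        Complex.exp_eq_one_iff.2 ⟨n, by ring⟩
      simp [this]
    rw [hcoeff n hn, hexp]
    simp

/-- if `g ∈ L¹([0,1])` satisfies the two functional equations
`(1/2)(g(x/2) + g((x+1)/2)) = g(x)` and `(1/2)(g(x/2) - g((x+1)/2)) = -cos(πx)·g(x)`
for almost every `x ∈ [0,1]`, then `g = 0` almost everywhere on `[0,1]`. -/
theorem ac_part_vanishes (g : ℝ → ℝ)
    (hg : IntegrableOn g (Set.Icc 0 1) volume)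
    (h1 : ∀ᵐ x ∂(volume.restrict (Set.Icc (0 : ℝ) 1)),
      (1 / 2) * (g (x / 2) + g ((x + 1) / 2)) = g x)
    (h2 : ∀ᵐ x ∂(volume.restrict (Set.Icc (0 : ℝ) 1)),
      (1 / 2) * (g (x / 2) - g ((x + 1) / 2)) = -Real.cos (π * x) * g x) :
    ∀ᵐ x ∂(volume.restrict (Set.Icc (0 : ℝ) 1)), g x = 0 := by
  have hconst := ae_const_of_doubling_transfer (f := fun x => (g x : ℂ)) hg.ofReal
    (by filter_upwards [h1] with x hx; rw [← hx]; push_cast; rfl)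
  rw [intervalIntegral.integral_ofReal] at hconst
  simp only [Complex.ofReal_inj] at hconst
  set c := ∫ t in (0 : ℝ)..1, g t
  have hhalf : Measure.QuasiMeasurePreserving (fun x : ℝ => x * 2⁻¹) volume volume :=
    ⟨by fun_prop, by
      rw [Real.map_volume_mul_right (by norm_num)]
      exact Measure.smul_absolutelyContinuous⟩
  have hconst' := hhalf.ae hconst
  rw [ae_restrict_iff' measurableSet_Icc] at h1 h2
  have hcos : ∀ᵐ x, x ∈ Set.Ioo (0 : ℝ) (1 / 2) → c = 0 := by
    filter_upwards [h1, h2, hconst, hconst'] with x hx1 hx2 hx3 hx4 hx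
    have hx3 := hx3 ⟨hx.1, by linarith [hx.2]⟩
    have hx4 := hx4 ⟨by linarith [hx.1], by linarith [hx.1, hx.2]⟩
    have hx1 := hx1 ⟨hx.1.le, by linarith [hx.2]⟩
    have hx2 := hx2 ⟨hx.1.le, by linarith [hx.2]⟩
    rw [← div_eq_mul_inv] at hx4
    rw [hx3, hx4] at hx1 hx2
    have hpos : 0 < Real.cos (π * x) :=
      Real.cos_pos_of_mem_Ioo ⟨by nlinarith [Real.pi_pos, hx.1], by nlinarith [Real.pi_pos, hx.2]⟩
    have : Real.cos (π * x) * c = 0 := by linarith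
    exact (mul_eq_zero.1 this).resolve_left hpos.ne'
  have hc : c = 0 := by
    by_contra hne
    have hnot : ∀ᵐ x, x ∉ Set.Ioo (0 : ℝ) (1 / 2) := hcos.mono fun x hx hx' => hne (hx hx')
    have := measure_eq_zero_iff_ae_notMem.2 hnot
    norm_num [Real.volume_Ioo] at this
  rw [← restrict_Ioo_eq_restrict_Icc, ae_restrict_iff' measurableSet_Ioo]
  simpa only [hc] using hconst
end
end

section
/- If h : ℕ → ℝ satisfies h(2m) = h(m) for all m ≥ 1, h(2m+1) = −(h(m) + h(m+1))/2 for all m ≥ 0, and h(m) → 0 as m → ∞, then h(m) = 0 for all m ∈ ℕ. -/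
open Filter Topology

/-- if `h : ℕ → ℝ` satisfies `h(2m) = h(m)` for `m ≥ 1`,
`h(2m+1) = -(h(m) + h(m+1))/2` for all `m ≥ 0`, and `h(m) → 0`, then `h ≡ 0`. -/
theorem recursion_with_limit_zero (h : ℕ → ℝ)
    (heven : ∀ m : ℕ, 1 ≤ m → h (2 * m) = h m)
    (hodd : ∀ m : ℕ, h (2 * m + 1) = -(h m + h (m + 1)) / 2)
    (hlim : Tendsto h atTop (nhds 0)) :
    ∀ m : ℕ, h m = 0 := by
  have hpow : ∀ m : ℕ, 1 ≤ m → ∀ k : ℕ, h (2 ^ k * m) = h m := by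
    intro m hm k
    induction k with
    | zero => simp
    | succ k ih =>
      rw [pow_succ', mul_assoc, heven _ (Nat.mul_pos (by positivity) hm), ih]
  have hpos : ∀ m : ℕ, 1 ≤ m → h m = 0 := by
    intro m hm
    have hsub : Tendsto (fun k : ℕ => 2 ^ k * m) atTop atTop :=
      (tendsto_pow_atTop_atTop_of_one_lt one_lt_two).atTop_mul_const' hm
    have hconst := hlim.comp hsub
    simp only [Function.comp_def, hpow m hm] at hconst
    exact tendsto_nhds_unique tendsto_const_nhds hconst
  intro m
  rcases Nat.eq_zero_or_pos m with rfl | hm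
  · have h_one := hodd 0
    norm_num [hpos 1 le_rfl] at h_one
    linarith
  · exact hpos m hm
end

section
/- For every fixed m ≥ 1, the coefficients c^{(n)}_m converge to the correlation coefficients: lim_{n→∞} c^{(n)}_m = η(m). -/
open Real MeasureTheory Filter Topology

noncomputable section

/-- The coefficients `c^{(n)}_m`: `c 1 0 = 0`, `c 1 1 = -1/2`, and for `n ≥ 1`,
`c (n+1) (2m) = c n m`, `c (n+1) 1 = -(1 + c n 1)/2`, and
`c (n+1) (2m+1) = -(c n m + c n (m+1))/2` for `m ≥ 1`. -/
def c : ℕ → ℕ → ℝ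
  | 0, _ => 0
  | 1, 0 => 0
  | 1, 1 => -(1 / 2)
  | 1, _ + 2 => 0
  | n + 2, m =>
    if m % 2 = 0 then c (n + 1) (m / 2)
    else if m = 1 then -(1 + c (n + 1) 1) / 2
    else -(c (n + 1) (m / 2) + c (n + 1) (m / 2 + 1)) / 2

theorem c_succ_one (n : ℕ) : c (n + 1) 1 = -(1 / 3) + -(1 / 6) * (-(1 / 2)) ^ n := by
  induction n with
  | zero => norm_num [c]
  | succ n ih =>
    rw [c, if_neg (by norm_num), if_pos rfl, ih]
    ring

theorem c_one_tendsto : Tendsto (fun n : ℕ => c n 1) atTop (𝓝 (-(1 / 3))) := by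
  rw [← tendsto_add_atTop_iff_nat 1]
  simp only [c_succ_one]
  have hpow : Tendsto (fun n : ℕ => (-(1 / 2) : ℝ) ^ n) atTop (𝓝 0) :=
    tendsto_pow_atTop_nhds_zero_of_abs_lt_one (by norm_num [abs_lt])
  simpa only [mul_zero, add_zero] using (hpow.const_mul (-(1 / 6) : ℝ)).const_add (-(1 / 3) : ℝ)

/-- for every fixed `m ≥ 1`, `c^{(n)}_m → η(m)` as `n → ∞`. -/
theorem c_tendsto_eta :
    ∀ m : ℕ, 1 ≤ m → Tendsto (fun n : ℕ => c n m) atTop (nhds (eta m)) := by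
  intro m
  induction m using Nat.strong_induction_on with
  | _ m ih =>
    intro hm
    match m, hm with
    | 1, _ =>
      rw [eta]
      exact c_one_tendsto
    | k + 2, _ =>
      rw [← tendsto_add_atTop_iff_nat 2, eta]
      have half : Tendsto (fun n : ℕ => c (n + 1) ((k + 2) / 2)) atTop
          (𝓝 (eta ((k + 2) / 2))) :=
        (tendsto_add_atTop_iff_nat 1).2 (ih _ (by omega) (by omega))
      by_cases hk : (k + 2) % 2 = 0
      · simpa only [c, if_pos hk] using half
      · have half_succ : Tendsto (fun n : ℕ => c (n + 1) ((k + 2) / 2 + 1)) atTop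
            (𝓝 (eta ((k + 2) / 2 + 1))) :=
          (tendsto_add_atTop_iff_nat 1).2 (ih _ (by omega) (by omega))
        have hk1 : k + 2 ≠ 1 := by omega
        simpa only [c, if_neg hk, if_neg hk1] using (half.add half_succ).neg.div_const 2
end
end
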